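/- Let p be an n×n real matrix with nonnegative entries and perm(p) > 0. Then there exists γ* ∈ [−1,0] such that perm(p) = Z_of^{γ*}(p); moreover Z_of^γ(p) ≤ perm(p) for every γ ∈ [−1,γ*] and Z_of^γ(p) ≥ perm(p) for every γ ∈ [γ*,1]. -/

import Mathlib

open scoped BigOperators

/-- The permanent of an `n × n` real matrix. -/
noncomputable def permanent {n : ℕ} (p : Matrix (Fin n) (Fin n) ℝ) : ℝ :=
  ∑ σ : Equiv.Perm (Fin n), ∏ i, p i (σ i)

/-- A matrix is doubly stochastic: nonnegative entries, all row and column sums equal 1. -/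
def DoublyStochastic {n : ℕ} (β : Matrix (Fin n) (Fin n) ℝ) : Prop :=
  (∀ i j, 0 ≤ β i j) ∧ (∀ i, ∑ j, β i j = 1) ∧ (∀ j, ∑ i, β i j = 1)

/-- Membership in the β-polytope `𝓑_p` of `p`. -/
def InPolytope {n : ℕ} (p β : Matrix (Fin n) (Fin n) ℝ) : Prop :=
  DoublyStochastic β ∧ ∀ i j, p i j = 0 → β i j = 0

/-- Membership in the interior of the β-polytope of `p`. -/
def InInterior {n : ℕ} (p β : Matrix (Fin n) (Fin n) ℝ) : Prop :=
  InPolytope p β ∧ ∀ i j, 0 < p i j → 0 < β i j ∧ β i j < 1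

/-- Bethe free energy `F_BP(β|p)` (sum over entries with `p i j > 0`;
the convention `0 * log 0 = 0` holds since `Real.log 0 = 0`). -/
noncomputable def FBP {n : ℕ} (p β : Matrix (Fin n) (Fin n) ℝ) : ℝ :=
  ∑ i, ∑ j, if 0 < p i j then
    β i j * Real.log (β i j / p i j) - (1 - β i j) * Real.log (1 - β i j)
  else 0

/-- Mean-field free energy `F_MF(β|p)`. -/
noncomputable def FMF {n : ℕ} (p β : Matrix (Fin n) (Fin n) ℝ) : ℝ :=
  ∑ i, ∑ j, if 0 < p i j then
    β i j * Real.log (β i j / p i j) + (1 - β i j) * Real.log (1 - β i j)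
  else 0

/-- Fractional free energy `F_f^γ(β|p)`. -/
noncomputable def Ff {n : ℕ} (γ : ℝ) (p β : Matrix (Fin n) (Fin n) ℝ) : ℝ :=
  ∑ i, ∑ j, if 0 < p i j then
    β i j * Real.log (β i j / p i j) + γ * ((1 - β i j) * Real.log (1 - β i j))
  else 0

/-- Optimal fractional partition function `Z_of^γ(p) = exp(-min_{β ∈ 𝓑_p} F_f^γ(β|p))`
(the minimum is expressed as an infimum; it is attained since `𝓑_p` is nonempty and
compact when `permanent p > 0` and `F_f^γ(·|p)` is continuous on it). -/
noncomputable def Zof {n : ℕ} (γ : ℝ) (p : Matrix (Fin n) (Fin n) ℝ) : ℝ :=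
  Real.exp (-(sInf ((fun β => Ff γ p β) '' {β | InPolytope p β})))


section MonomerDimer
variable {ι : Type*} [DecidableEq ι]

/-- Monomer-dimer partition function on the vertex sets `S`, `T`, edges from a list. -/
noncomputable def ZM (p : ι → ι → ℝ) (A B : ι → ℝ) : List (ι × ι) → Finset ι → Finset ι → ℝ
  | [], S, T => (∏ i ∈ S, A i) * ∏ j ∈ T, B j
  | e :: l, S, T => ZM p A B l S T +
      if e.1 ∈ S ∧ e.2 ∈ T then p e.1 e.2 * ZM p A B l (S.erase e.1) (T.erase e.2) else 0

lemma ZM_nonneg (p : ι → ι → ℝ) (A B : ι → ℝ) (hp : ∀ i j, 0 ≤ p i j) (hA : ∀ i, 0 ≤ A i)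
    (hB : ∀ i, 0 ≤ B i) (l : List (ι × ι)) : ∀ S T, 0 ≤ ZM p A B l S T := by
  induction l with
  | nil => 
    intro S T
    exact mul_nonneg (Finset.prod_nonneg fun i _ => hA i) (Finset.prod_nonneg fun i _ => hB i)
  | cons e l ih =>
    intro S T
    rw [ZM]
    split_ifs
    · exact add_nonneg (ih _ _) (mul_nonneg (hp _ _) (ih _ _))
    · simpa using ih S T

lemma ZM_swap (p : ι → ι → ℝ) (A B : ι → ℝ) (l : List (ι × ι)) : ∀ S T,
    ZM (fun i j => p j i) B A (l.map Prod.swap) T S = ZM p A B l S T := by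
  induction l with
  | nil => intro S T; simp [ZM, mul_comm]
  | cons e l ih =>
    intro S T
    simp [ZM, ih, and_comm]

lemma ZM_expand (p : ι → ι → ℝ) (A B : ι → ℝ) (l : List (ι × ι)) : ∀ S T, ∀ i ∈ S,
    ZM p A B l S T = A i * ZM p A B l (S.erase i) T +
      ∑ k ∈ T, (l.count (i, k) : ℝ) * p i k * ZM p A B l (S.erase i) (T.erase k) := by
  induction l with
  | nil => 
    intro S T i hi
    simp [ZM, ← Finset.mul_prod_erase S A hi, mul_assoc]
  | cons e l ih =>
    intro S T i hi
    obtain ⟨a, b⟩ := e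
    by_cases hai : a = i
    · subst hai
      simp only [ZM, hi, true_and, Finset.mem_erase, ne_eq, not_true_eq_false, false_and, if_false, 
        add_zero]
      rw [ih S T a hi]
      have : ∀ k ∈ T, (((a, b) :: l).count (a, k) : ℝ) * p a k * ZM p A B l (S.erase a) (T.erase k)
        = (l.count (a, k) : ℝ) * p a k * ZM p A B l (S.erase a) (T.erase k) +
          if k = b then p a b * ZM p A B l (S.erase a) (T.erase b) else 0 := by
        intro k _
        rw [List.count_cons]
        by_cases hk : k = b
        · subst hk; simp; ring
        · have : b ≠ k := fun h => hk h.symm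
          simp [hk, this]
      rw [Finset.sum_congr rfl this, Finset.sum_add_distrib, Finset.sum_ite_eq']
      ring
    · have hc : ∀ k, ((a, b) :: l).count (i, k) = l.count (i, k) := by
        intro k
        rw [List.count_cons]; simp [hai]
      simp only [hc, ZM]
      by_cases haS : a ∈ S
      · have hi' : i ∈ S.erase a := Finset.mem_erase.2 ⟨fun h => hai h.symm, hi⟩
        rw [ih S T i hi]
        by_cases hb : b ∈ T
        · rw [ih (S.erase a) (T.erase b) i hi']
          simp only [haS, hb, hai, Finset.mem_erase, ne_eq, not_false_eq_true, true_and, and_true, 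
            if_true]
          have : ∀ k ∈ T, (l.count (i, k) : ℝ) * p i k * (ZM p A B l (S.erase i) (T.erase k) + 
              if ¬ b = k then p a b * ZM p A B l ((S.erase i).erase a) ((T.erase k).erase b) else 0)
            = (l.count (i, k) : ℝ) * p i k * ZM p A B l (S.erase i) (T.erase k) +
              p a b * (if ¬ b = k then (l.count (i, k) : ℝ) * p i k *
                ZM p A B l ((S.erase a).erase i) ((T.erase b).erase k) else 0) := by
            intro k _
            rw [Finset.erase_right_comm, Finset.erase_right_comm (s := T)]
            split_ifs <;> ring
          rw [Finset.sum_congr rfl this, Finset.sum_add_distrib, ← Finset.mul_sum,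
            ← Finset.sum_filter]
          have h2 : T.filter (fun k => ¬ b = k) = T.erase b := by
            ext k; simp [and_comm, eq_comm]
          rw [h2, Finset.erase_right_comm (s := S)]
          ring
        · simp [hb]
      · simp [haS, ← ih S T i hi]

lemma ZM_corr (m : ℕ) : ∀ (p : ι → ι → ℝ) (A B : ι → ℝ), (∀ i j, 0 ≤ p i j) → (∀ i, 0 ≤ A i) →
    (∀ i, 0 ≤ B i) → ∀ (l : List (ι × ι)) (S T : Finset ι), S.card + T.card ≤ m →
    (∀ i ∈ S, ∀ j ∈ T, ZM p A B l (S.erase i) T * ZM p A B l S (T.erase j) ≤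
      ZM p A B l S T * ZM p A B l (S.erase i) (T.erase j)) ∧
    (∀ i ∈ S, ∀ i' ∈ S, i ≠ i' → ZM p A B l S T * ZM p A B l ((S.erase i).erase i') T ≤
      ZM p A B l (S.erase i) T * ZM p A B l (S.erase i') T) := by
  induction m with
  | zero =>
    intro p A B hp hA hB l S T h
    have : S = ∅ := by rw [← Finset.card_eq_zero]; omega
    subst this; simp
  | succ m ih =>
    intro p A B hp hA hB l S T h
    have hlt : ∀ i ∈ S, (S.erase i).card + T.card ≤ m := by
      intro i hi
      have := Finset.card_erase_lt_of_mem hi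
      omega
    have hn := ZM_nonneg p A B hp hA hB l
    have hw : ∀ i k, 0 ≤ (l.count (i, k) : ℝ) * p i k := 
      fun i k => mul_nonneg (Nat.cast_nonneg _) (hp _ _)
    constructor
    · intro i hi j hj
      rw [ZM_expand p A B l S T i hi, ZM_expand p A B l S (T.erase j) i hi]
      rw [← Finset.add_sum_erase T _ hj]
      have hs : (∑ k ∈ T.erase j, (l.count (i, k) : ℝ) * p i k *
            ZM p A B l (S.erase i) ((T.erase j).erase k)) * ZM p A B l (S.erase i) T ≤
          (∑ k ∈ T.erase j, (l.count (i, k) : ℝ) * p i k * ZM p A B l (S.erase i) (T.erase k)) *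
            ZM p A B l (S.erase i) (T.erase j) := by
        rw [Finset.sum_mul, Finset.sum_mul]
        apply Finset.sum_le_sum
        intro k hk
        obtain ⟨hkj, hkT⟩ := Finset.mem_erase.1 hk
        have := (ih (fun i j => p j i) B A (fun i j => hp j i) hB hA (l.map Prod.swap) T (S.erase i)
          (by have := hlt i hi; omega)).2 j hj k hkT (fun h => hkj h.symm)
        simp only [ZM_swap] at this
        nlinarith [mul_le_mul_of_nonneg_left this (hw i k)]
      have := mul_nonneg (hw i j) (mul_self_nonneg (ZM p A B l (S.erase i) (T.erase j)))
      nlinarith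
    · intro i hi i' hi' hne
      have hii : i ∈ S.erase i' := Finset.mem_erase.2 ⟨hne, hi⟩
      have hii' : i' ∈ S.erase i := Finset.mem_erase.2 ⟨fun h => hne h.symm, hi'⟩
      rw [ZM_expand p A B l S T i hi, ZM_expand p A B l (S.erase i') T i hii]
      rw [Finset.erase_right_comm (a := i')]
      have hs : (∑ k ∈ T, (l.count (i, k) : ℝ) * p i k * ZM p A B l (S.erase i) (T.erase k)) * 
          ZM p A B l ((S.erase i).erase i') T ≤ 
          (∑ k ∈ T, (l.count (i, k) : ℝ) * p i k * 
            ZM p A B l ((S.erase i).erase i') (T.erase k)) * ZM p A B l (S.erase i) T := by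
        rw [Finset.sum_mul, Finset.sum_mul]
        apply Finset.sum_le_sum
        intro k hk
        have := (ih p A B hp hA hB l (S.erase i) T (hlt i hi)).1 i' hii' k hk
        nlinarith [mul_le_mul_of_nonneg_left this (hw i k)]
      nlinarith

lemma ZM_congr (p : ι → ι → ℝ) (A A' B B' : ι → ℝ) (l : List (ι × ι)) : ∀ S T,
    (∀ i ∈ S, A i = A' i) → (∀ j ∈ T, B j = B' j) → ZM p A B l S T = ZM p A' B' l S T := by
  induction l with
  | nil => 
    intro S T h1 h2
    simp only [ZM]
    rw [Finset.prod_congr rfl h1, Finset.prod_congr rfl h2]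
  | cons e l ih =>
    intro S T h1 h2
    simp only [ZM]
    rw [ih S T h1 h2, ih (S.erase e.1) (T.erase e.2) (fun i hi => h1 i (Finset.mem_of_mem_erase hi))
      (fun i hi => h2 i (Finset.mem_of_mem_erase hi))]

lemma ZM_affine (p : ι → ι → ℝ) (A A' B : ι → ℝ) (l : List (ι × ι)) (S T : Finset ι) (i : ι)
    (hi : i ∈ S) (s : ℝ) (h : ∀ k, A k = A' k + if k = i then s else 0) : 
    ZM p A B l S T = ZM p A' B l S T + s * ZM p A' B l (S.erase i) T := by
  have hc : ∀ U, ZM p A B l (S.erase i) U = ZM p A' B l (S.erase i) U := by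
    intro U
    apply ZM_congr
    · intro k hk
      rw [h, if_neg (Finset.ne_of_mem_erase hk), add_zero]
    · simp
  rw [ZM_expand p A B l S T i hi, ZM_expand p A' B l S T i hi]
  simp only [hc, h i, if_true]
  ring

lemma ZM_affine2 (p : ι → ι → ℝ) (A A' B B' : ι → ℝ) (l : List (ι × ι)) (S T : Finset ι) (i j : ι)
    (hi : i ∈ S) (hj : j ∈ T) (s t : ℝ) (hA : ∀ k, A k = A' k + if k = i then s else 0)
    (hB : ∀ k, B k = B' k + if k = j then t else 0) : 
    ZM p A B l S T = ZM p A' B' l S T + ZM p A' B' l (S.erase i) T * s + 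
      ZM p A' B' l S (T.erase j) * t + ZM p A' B' l (S.erase i) (T.erase j) * (s * t) := by
  have h2 : ∀ S, ZM p A' B l S T = ZM p A' B' l S T + t * ZM p A' B' l S (T.erase j) := by
    intro S
    have := ZM_affine (fun i j => p j i) B B' A' (l.map Prod.swap) T S j hj t hB
    simpa only [ZM_swap] using this
  rw [ZM_affine p A A' B l S T i hi s hA, h2, h2]
  ring

lemma ZM_perm (p : ι → ι → ℝ) (l : List (ι × ι)) (hl : ∀ i j, l.count (i, j) = 1) (m : ℕ) : 
    ∀ (r c : Fin m → ι), Function.Injective r → Function.Injective c →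
    ZM p 0 0 l (Finset.univ.image r) (Finset.univ.image c) = 
      ∑ σ : Equiv.Perm (Fin m), ∏ i, p (r i) (c (σ i)) := by
  induction m with
  | zero => 
    intro r c _ _
    simp
    have : ∀ l : List (ι × ι), ZM p 0 0 l ∅ ∅ = 1 := by
      intro l
      induction l with
      | nil => simp [ZM]
      | cons e l ih => simp [ZM, ih]
    exact this l
  | succ m ih =>
    intro r c hr hc
    rw [ZM_expand p 0 0 l _ _ (r 0) (Finset.mem_image_of_mem _ (Finset.mem_univ _))]
    simp only [hl, Pi.zero_apply, zero_mul, zero_add, Nat.cast_one, one_mul]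
    rw [Finset.sum_image (fun a _ b _ h => hc h)]
    rw [← Equiv.sum_comp (Equiv.Perm.decomposeFin (n := m)).symm, Fintype.sum_prod_type]
    apply Finset.sum_congr rfl
    intro q _
    simp only [Fin.prod_univ_succ, Equiv.Perm.decomposeFin_symm_apply_zero,
      Equiv.Perm.decomposeFin_symm_apply_succ]
    rw [← Finset.mul_sum]
    congr 1
    have h1 : (Finset.univ.image r).erase (r 0) = Finset.univ.image (fun x : Fin m => r x.succ) := by
      ext x
      simp only [Finset.mem_erase, Finset.mem_image, Finset.mem_univ, true_and]
      constructor
      · rintro ⟨h, a, rfl⟩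
        have : a ≠ 0 := fun h' => h (by rw [h'])
        obtain ⟨b, rfl⟩ := Fin.exists_succ_eq.2 this
        exact ⟨b, rfl⟩
      · rintro ⟨b, rfl⟩
        exact ⟨fun h => Fin.succ_ne_zero _ (hr h), _, rfl⟩
    have h2 : (Finset.univ.image c).erase (c q) = 
        Finset.univ.image (fun x : Fin m => c (Equiv.swap 0 q x.succ)) := by
      ext x
      simp only [Finset.mem_erase, Finset.mem_image, Finset.mem_univ, true_and]
      constructor
      · rintro ⟨h, a, rfl⟩
        have h3 : a ≠ q := fun h' => h (by rw [h'])
        have : Equiv.swap 0 q a ≠ 0 := by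
          intro h4
          apply h3
          have := congrArg (Equiv.swap 0 q) h4
          simpa using this
        obtain ⟨b, hb⟩ := Fin.exists_succ_eq.2 this
        exact ⟨b, by rw [hb]; simp⟩
      · rintro ⟨b, rfl⟩
        refine ⟨fun h => ?_, _, rfl⟩
        have h4 := congrArg (Equiv.swap 0 q) (hc h)
        simp at h4
    rw [h1, h2]
    exact ih _ _ (fun a b h => Fin.succ_injective _ (hr h)) 
      (fun a b h => Fin.succ_injective _ ((Equiv.swap 0 q).injective (hc h)))

end MonomerDimer

section Bethe

lemma key_zero (a b c d K : ℝ) (hf : ∀ s t : ℝ, 0 < s → 0 < t → K ≤ a + b * s + c * t + d * (s * t)) :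
    K ≤ a := by
  have h1 : Filter.Tendsto (fun s : ℝ => a + b * s + c * s + d * (s * s)) (nhdsWithin 0 (Set.Ioi 0))
      (nhds a) := by
    have : ContinuousAt (fun s : ℝ => a + b * s + c * s + d * (s * s)) 0 := by fun_prop
    have h2 := this.tendsto
    simp only [mul_zero, add_zero] at h2
    exact h2.mono_left nhdsWithin_le_nhds
  refine ge_of_tendsto h1 ?_
  filter_upwards [self_mem_nhdsWithin] with s hs
  exact hf s s hs hs

lemma key_one (a b c d K : ℝ)
    (hf : ∀ s t : ℝ, 0 < s → 0 < t → K * (s * t) ≤ a + b * s + c * t + d * (s * t)) :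
    K ≤ d := by
  apply key_zero d c b a K
  intro s t hs ht
  have h := hf s⁻¹ t⁻¹ (inv_pos.2 hs) (inv_pos.2 ht)
  have h2 := mul_le_mul_of_nonneg_right h (mul_pos hs ht).le
  have e1 : K * (s⁻¹ * t⁻¹) * (s * t) = K := by field_simp
  have e2 : (a + b * s⁻¹ + c * t⁻¹ + d * (s⁻¹ * t⁻¹)) * (s * t) = d + c * s + b * t + a * (s * t) := by
    field_simp
    ring
  rwa [e1, e2] at h2

lemma key_pos (a b c d K α : ℝ) (ha : 0 < a) (hb : 0 ≤ b) (hc : 0 ≤ c) (hd : 0 < d)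
    (h : b * c ≤ a * d) (h0 : 0 < α) (h1 : α < 1)
    (hf : ∀ s t : ℝ, 0 < s → 0 < t → K * (s ^ α * t ^ α) ≤ a + b * s + c * t + d * (s * t)) :
    K * (α ^ α * (1 - α) ^ (1 - α)) ≤ a + d := by
  have h1' : 0 < 1 - α := by linarith
  set u := α / (1 - α) with hu
  have hup : 0 < u := div_pos h0 h1'
  obtain ⟨s, t, hs, ht, hst, hbs, hct⟩ : ∃ s t : ℝ, 0 < s ∧ 0 < t ∧ s * t = u ^ 2 * a / d ∧
      b * s ≤ a * u ∧ c * t ≤ a * u := by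
    rcases hc.eq_or_lt with hc | hc
    · refine ⟨a * u / (b + 1), u ^ 2 * a / d / (a * u / (b + 1)), by positivity, by positivity, ?_, ?_, ?_⟩
      · field_simp
      · rw [← mul_div_assoc, div_le_iff₀ (by positivity)]
        have : 0 ≤ a * u := by positivity
        nlinarith
      · rw [← hc]; simp; positivity
    · refine ⟨u * c / d, u * a / c, by positivity, by positivity, ?_, ?_, ?_⟩
      · field_simp
      · rw [← mul_div_assoc, div_le_iff₀ hd]
        nlinarith
      · apply le_of_eq; field_simp
  have hX : 0 < u ^ 2 * a / d := by positivity
  have hf1 := hf s t hs ht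
  rw [← Real.mul_rpow hs.le ht.le, hst] at hf1
  have hf2 : K * (u ^ 2 * a / d) ^ α ≤ a / (1 - α) ^ 2 := by
    have e : a / (1 - α) ^ 2 = a + a * u + a * u + d * (u ^ 2 * a / d) := by
      rw [hu]; field_simp; ring
    rw [e]; linarith
  have e3 : a / (1 - α) ^ 2 * (α ^ α * (1 - α) ^ (1 - α)) = 
      ((a / (1 - α)) ^ (1 - α) * (d / α) ^ α) * (u ^ 2 * a / d) ^ α := by
    apply Real.log_injOn_pos
    · exact Set.mem_Ioi.2 (by positivity)
    · exact Set.mem_Ioi.2 (by positivity)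
    rw [Real.log_mul (by positivity) (by positivity), Real.log_mul (by positivity) (by positivity),
      Real.log_mul (by positivity) (by positivity), Real.log_mul (by positivity) (by positivity),
      Real.log_rpow h0, Real.log_rpow h1', Real.log_rpow (by positivity), 
      Real.log_rpow (by positivity), Real.log_rpow (by positivity), 
      Real.log_div (by positivity) (by positivity), Real.log_div (by positivity) (by positivity),
      Real.log_div (by positivity) (by positivity), Real.log_div (by positivity) (by positivity),
      Real.log_mul (by positivity) (by positivity), Real.log_pow, Real.log_pow, hu,
      Real.log_div (by positivity) (by positivity)]
    push_cast
    ring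
  have e4 : (a / (1 - α)) ^ (1 - α) * (d / α) ^ α ≤ a + d := by
    have := Real.geom_mean_le_arith_mean2_weighted (w₁ := 1 - α) (w₂ := α) (p₁ := a / (1 - α)) 
      (p₂ := d / α) h1'.le h0.le (by positivity) (by positivity) (by ring)
    have e5 : (1 - α) * (a / (1 - α)) + α * (d / α) = a + d := by field_simp
    linarith
  have hY : 0 < α ^ α * (1 - α) ^ (1 - α) := by positivity
  have hXa : 0 < (u ^ 2 * a / d) ^ α := by positivity
  refine le_trans ?_ e4
  refine le_of_mul_le_mul_right ?_ hXa
  rw [← e3]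
  have := mul_le_mul_of_nonneg_right hf2 hY.le
  linarith

lemma key_w1 (a b c d K α : ℝ) (ha : 0 ≤ a) (hb : 0 ≤ b) (hc : 0 ≤ c) (hd : 0 ≤ d)
    (h : b * c ≤ a * d) (h0 : 0 ≤ α) (h1 : α ≤ 1)
    (hf : ∀ s t : ℝ, 0 < s → 0 < t → K * (s ^ α * t ^ α) ≤ a + b * s + c * t + d * (s * t)) :
    K * (α ^ α * (1 - α) ^ (1 - α)) ≤ a + d := by
  rcases h0.eq_or_lt with h0 | h0
  · subst h0
    simp at hf ⊢
    linarith [key_zero a b c d K hf]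
  rcases h1.eq_or_lt with h1 | h1
  · subst h1
    simp at hf ⊢
    linarith [key_one a b c d K hf]
  refine le_of_forall_pos_le_add ?_
  intro ε hε
  have := key_pos (a + ε / 2) b c (d + ε / 2) K α (by positivity) hb hc (by positivity)
    (by nlinarith [mul_nonneg ha hε.le, mul_nonneg hd hε.le, mul_pos hε hε]) h0 h1 (by
      intro s t hs ht
      have := hf s t hs ht
      have : 0 < ε / 2 * (s * t) := by positivity
      linarith)
  linarith

lemma key_w (a b c d K α p : ℝ) (ha : 0 ≤ a) (hb : 0 ≤ b) (hc : 0 ≤ c) (hd : 0 ≤ d)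
    (h : b * c ≤ a * d) (h0 : 0 ≤ α) (h1 : α ≤ 1) (hp : 0 ≤ p) (hpα : p = 0 → α = 0)
    (hf : ∀ s t : ℝ, 0 < s → 0 < t → K * (s ^ α * t ^ α) ≤ a + b * s + c * t + d * (s * t)) :
    K * (p ^ α * (α ^ α * (1 - α) ^ (1 - α))) ≤ a + p * d := by
  rcases hp.eq_or_lt with hp0 | hp0
  · have := hpα hp0.symm
    subst this
    subst hp0
    simp at hf ⊢
    exact key_zero a b c d K hf
  · have := key_w1 a (b * p) c (d * p) (K * p ^ α) α ha (by positivity) hc (by positivity) 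
      (by nlinarith) h0 h1 (by
        intro s t hs ht
        have := hf (p * s) t (by positivity) ht
        rw [Real.mul_rpow hp hs.le] at this
        linarith)
    linarith

variable {n : ℕ}

/-- Remaining row weights. -/
noncomputable def remA (l : List (Fin n × Fin n)) (y : Fin n × Fin n → ℝ) (i : Fin n) : ℝ :=
  ∑ j, if (i, j) ∈ l then 0 else y (i, j)

/-- Remaining column weights. -/
noncomputable def remB (l : List (Fin n × Fin n)) (y : Fin n × Fin n → ℝ) (j : Fin n) : ℝ :=
  ∑ i, if (i, j) ∈ l then 0 else y (i, j)

/-- Final factor of an edge. -/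
noncomputable def kap (p β : Matrix (Fin n) (Fin n) ℝ) (e : Fin n × Fin n) : ℝ :=
  (β e.1 e.2)⁻¹ ^ (β e.1 e.2) * (β e.1 e.2)⁻¹ ^ (β e.1 e.2) * 
   ((p e.1 e.2) ^ (β e.1 e.2) * ((β e.1 e.2) ^ (β e.1 e.2) * (1 - β e.1 e.2) ^ (1 - β e.1 e.2)))

/-- Current factor of an edge. -/
noncomputable def fac (p β : Matrix (Fin n) (Fin n) ℝ) (l : List (Fin n × Fin n))
    (y z : Fin n × Fin n → ℝ) (e : Fin n × Fin n) : ℝ :=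
  if e ∈ l then kap p β e else 
    (y e * (β e.1 e.2)⁻¹) ^ (β e.1 e.2) * (z e * (β e.1 e.2)⁻¹) ^ (β e.1 e.2)

lemma rem_aux (l : List (Fin n × Fin n)) (y : Fin n × Fin n → ℝ) (e : Fin n × Fin n) (he : e ∉ l) 
    (s : ℝ) (f : Fin n × Fin n) : (if f ∈ l then 0 else Function.update y e s f) = 
      (if f ∈ e :: l then 0 else y f) + if f = e then s else 0 := by
  by_cases hfe : f = e
  · subst hfe; simp [he]
  · simp [hfe]

lemma remA_update (l : List (Fin n × Fin n)) (y : Fin n × Fin n → ℝ) (e : Fin n × Fin n) (he : e ∉ l) 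
    (s : ℝ) (k : Fin n) : remA l (Function.update y e s) k = 
      remA (e :: l) y k + if k = e.1 then s else 0 := by
  unfold remA
  simp_rw [rem_aux l y e he s]
  rw [Finset.sum_add_distrib]
  congr 1
  obtain ⟨a, b⟩ := e
  by_cases h : k = a <;> simp [h]

lemma remB_update (l : List (Fin n × Fin n)) (y : Fin n × Fin n → ℝ) (e : Fin n × Fin n) (he : e ∉ l) 
    (s : ℝ) (k : Fin n) : remB l (Function.update y e s) k = 
      remB (e :: l) y k + if k = e.2 then s else 0 := by
  unfold remB
  simp_rw [rem_aux l y e he s]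
  rw [Finset.sum_add_distrib]
  congr 1
  obtain ⟨a, b⟩ := e
  by_cases h : k = b <;> simp [h]

lemma amgm_row (β y : Fin n → ℝ) (hβ : ∀ j, 0 ≤ β j) (hs : ∑ j, β j = 1) (hy : ∀ j, 0 < y j) :
    ∏ j, (y j * (β j)⁻¹) ^ (β j) ≤ ∑ j, y j := by
  refine (Real.geom_mean_le_arith_mean_weighted Finset.univ β (fun j => y j * (β j)⁻¹) 
    (fun j _ => hβ j) hs (fun j _ => mul_nonneg (hy j).le (inv_nonneg.2 (hβ j)))).trans ?_
  apply Finset.sum_le_sum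
  intro j _
  rcases (hβ j).eq_or_lt with h | h
  · rw [← h]; simp [(hy j).le]
  · apply le_of_eq; field_simp

lemma bethe_ind (p β : Matrix (Fin n) (Fin n) ℝ) (hp : ∀ i j, 0 ≤ p i j) (hβ : InPolytope p β)
    (hβ1 : ∀ i j, β i j ≤ 1) (l : List (Fin n × Fin n)) : l.Nodup → 
    ∀ y z : Fin n × Fin n → ℝ, (∀ e, 0 < y e) → (∀ e, 0 < z e) → 
    ∏ e, fac p β l y z e ≤ ZM p (remA l y) (remB l z) l Finset.univ Finset.univ := by
  obtain ⟨⟨hβ0, hr, hcs⟩, hsupp⟩ := hβ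
  induction l with
  | nil =>
    intro _ y z hy hz
    simp only [fac, List.not_mem_nil, if_false, ZM, remA, remB]
    rw [Finset.prod_mul_distrib]
    have hn : ∀ y : Fin n × Fin n → ℝ, (∀ e, 0 < y e) → ∀ i j, 
        0 ≤ (y (i, j) * (β i j)⁻¹) ^ (β i j) := fun y hy i j => 
      Real.rpow_nonneg (mul_nonneg (hy _).le (inv_nonneg.2 (hβ0 _ _))) _
    apply mul_le_mul
    · rw [Fintype.prod_prod_type]
      exact Finset.prod_le_prod (fun i _ => Finset.prod_nonneg fun j _ => hn y hy i j) 
        (fun i _ => amgm_row (β i) (fun j => y (i, j)) (hβ0 i) (hr i) (fun j => hy _))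
    · rw [Fintype.prod_prod_type_right]
      exact Finset.prod_le_prod (fun i _ => Finset.prod_nonneg fun j _ => hn z hz _ _) 
        (fun j _ => amgm_row (fun i => β i j) (fun i => z (i, j)) (fun i => hβ0 i j) (hcs j) 
          (fun j => hz _))
    · exact Finset.prod_nonneg fun e _ => hn z hz e.1 e.2
    · exact Finset.prod_nonneg fun e _ => Finset.sum_nonneg fun j _ => (hy _).le
  | cons e l ih =>
    intro hnd y z hy hz
    obtain ⟨he, hnd⟩ := List.nodup_cons.1 hnd
    have ih := ih hnd
    have hA : ∀ i, 0 ≤ remA (e :: l) y i := fun i => Finset.sum_nonneg fun j _ => by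
      split_ifs; exacts [le_rfl, (hy _).le]
    have hB : ∀ i, 0 ≤ remB (e :: l) z i := fun i => Finset.sum_nonneg fun j _ => by
      split_ifs; exacts [le_rfl, (hz _).le]
    have hn := ZM_nonneg p _ _ hp hA hB l
    have hcorr := (ZM_corr _ p _ _ hp hA hB l Finset.univ Finset.univ le_rfl).1 e.1 
      (Finset.mem_univ _) e.2 (Finset.mem_univ _)
    simp only [ZM, Finset.mem_univ, and_self, if_true]
    set K0 := ∏ f ∈ Finset.univ.erase e, fac p β (e :: l) y z f with hK0
    set i := (β e.1 e.2)⁻¹ ^ (β e.1 e.2) with hi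
    have hK := key_w _ _ _ _ (K0 * (i * i)) (β e.1 e.2) (p e.1 e.2) (hn _ _) (hn _ _) (hn _ _) (hn _ _)
      hcorr (hβ0 _ _) (hβ1 _ _) (hp _ _) (hsupp _ _) (by
        intro s t hs ht
        rw [← ZM_affine2 p (remA l (Function.update y e s)) _ (remB l (Function.update z e t)) _ l
          Finset.univ Finset.univ e.1 e.2 (Finset.mem_univ _) (Finset.mem_univ _) s t 
          (remA_update l y e he s) (remB_update l z e he t)]
        have hpos : ∀ (y : Fin n × Fin n → ℝ) (s : ℝ), 0 < s → (∀ e, 0 < y e) → 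
            ∀ f, 0 < Function.update y e s f := by
          intro y s hs hy f
          by_cases hfe : f = e
          · subst hfe; simpa
          · simpa [hfe] using hy f
        refine le_trans (le_of_eq ?_) (ih _ _ (hpos y s hs hy) (hpos z t ht hz))
        rw [← Finset.mul_prod_erase _ _ (Finset.mem_univ e)]
        have h1 : ∀ f ∈ Finset.univ.erase e, fac p β l (Function.update y e s) 
            (Function.update z e t) f = fac p β (e :: l) y z f := by
          intro f hf
          have hfe := Finset.ne_of_mem_erase hf
          simp [fac, hfe]
        rw [Finset.prod_congr rfl h1, ← hK0]
        simp only [fac, he, if_false, Function.update_self]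
        rw [Real.mul_rpow hs.le (inv_nonneg.2 (hβ0 _ _)), Real.mul_rpow ht.le (inv_nonneg.2 (hβ0 _ _)),
          ← hi]
        ring)
    refine le_trans (le_of_eq ?_) hK
    rw [← Finset.mul_prod_erase _ _ (Finset.mem_univ e), ← hK0]
    simp only [fac, List.mem_cons, true_or, if_true, kap, ← hi]
    ring

lemma bethe_perm (p β : Matrix (Fin n) (Fin n) ℝ) (hp : ∀ i j, 0 ≤ p i j) (hβ : InPolytope p β)
    (hβ1 : ∀ i j, β i j ≤ 1) : ∏ e, kap p β e ≤ permanent p := by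
  have h := bethe_ind p β hp hβ hβ1 (Finset.univ : Finset (Fin n × Fin n)).toList 
    (Finset.nodup_toList _) (fun _ => 1) (fun _ => 1) (fun _ => one_pos) (fun _ => one_pos)
  have hA : remA (Finset.univ : Finset (Fin n × Fin n)).toList (fun _ => 1) = 0 := by
    ext i; simp [remA]
  have hB : remB (Finset.univ : Finset (Fin n × Fin n)).toList (fun _ => 1) = 0 := by
    ext i; simp [remB]
  have hP := ZM_perm p (Finset.univ : Finset (Fin n × Fin n)).toList 
    (fun i j => List.count_eq_one_of_mem (Finset.nodup_toList _) (by simp)) n id id 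
    Function.injective_id Function.injective_id
  simp only [Finset.image_id, id] at hP
  rw [hA, hB, hP] at h
  simpa [fac, permanent] using h

lemma kap_eq (p β : Matrix (Fin n) (Fin n) ℝ) (hp : ∀ i j, 0 ≤ p i j) (hβ : InPolytope p β)
    (hβ1 : ∀ i j, β i j ≤ 1) (i j : Fin n) : kap p β (i, j) = Real.exp (-(if 0 < p i j then
    β i j * Real.log (β i j / p i j) + (-1) * ((1 - β i j) * Real.log (1 - β i j))
  else 0)) := by
  obtain ⟨⟨hβ0, hr, hcs⟩, hsupp⟩ := hβ
  simp only [kap]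
  rcases (hp i j).eq_or_lt with h | h
  · rw [hsupp i j h.symm, ← h]; simp
  rw [if_pos h]
  rcases (hβ0 i j).eq_or_lt with h0 | h0
  · rw [← h0]; simp
  have e1 : (1 - β i j) ^ (1 - β i j) = Real.exp ((1 - β i j) * Real.log (1 - β i j)) := by
    rcases (hβ1 i j).eq_or_lt with h1 | h1
    · rw [h1]; simp
    · rw [Real.rpow_def_of_pos (by linarith), mul_comm]
  rw [e1, Real.rpow_def_of_pos (inv_pos.2 h0), Real.rpow_def_of_pos h0, Real.rpow_def_of_pos h,
    ← Real.exp_add, ← Real.exp_add, ← Real.exp_add, ← Real.exp_add, Real.log_inv, 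
    Real.log_div h0.ne' h.ne']
  congr 1
  ring

lemma InPolytope.le_one {p β : Matrix (Fin n) (Fin n) ℝ} (hβ : InPolytope p β) (i j : Fin n) :
    β i j ≤ 1 := by
  rw [← hβ.1.2.1 i]
  exact Finset.single_le_sum (fun k _ => hβ.1.1 i k) (Finset.mem_univ j)

lemma bethe_le (p β : Matrix (Fin n) (Fin n) ℝ) (hp : ∀ i j, 0 ≤ p i j) (hβ : InPolytope p β) :
    Real.exp (-Ff (-1) p β) ≤ permanent p := by
  have h := bethe_perm p β hp hβ hβ.le_one
  rw [Fintype.prod_prod_type] at h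
  simp_rw [kap_eq p β hp hβ hβ.le_one, ← Real.exp_sum] at h
  simpa only [Ff, Finset.sum_neg_distrib] using h

end Bethe

section Final
variable {n : ℕ}

lemma permanent_le_one (β : Matrix (Fin n) (Fin n) ℝ) (hβ : DoublyStochastic β) :
    permanent β ≤ 1 := by
  have h1 : ∏ i : Fin n, ∑ j, β i j = 1 := by simp [hβ.2.1]
  have h2 := Finset.prod_univ_sum (fun _ : Fin n => (Finset.univ : Finset (Fin n))) (fun i j => β i j)
  rw [← h1, h2, permanent]
  have hinj : Function.Injective (fun σ : Equiv.Perm (Fin n) => (σ : Fin n → Fin n)) := 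
    DFunLike.coe_injective
  rw [← Finset.sum_image (s := Finset.univ) (g := fun σ : Equiv.Perm (Fin n) => (σ : Fin n → Fin n)) 
    (f := fun f => ∏ i, β i (f i)) (fun a _ b _ h => hinj h)]
  apply Finset.sum_le_sum_of_subset_of_nonneg
  · intro f _; simp
  · intro f _ _
    exact Finset.prod_nonneg fun i _ => hβ.1 _ _

lemma mf_exists (p : Matrix (Fin n) (Fin n) ℝ) (hp : ∀ i j, 0 ≤ p i j) (hperm : 0 < permanent p) :
    ∃ β, InPolytope p β ∧ Ff 0 p β ≤ -Real.log (permanent p) := by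
  set D := permanent p with hD
  set μ : Equiv.Perm (Fin n) → ℝ := fun σ => (∏ i, p i (σ i)) / D with hμ
  have hμ0 : ∀ σ, 0 ≤ μ σ := fun σ => div_nonneg (Finset.prod_nonneg fun i _ => hp _ _) hperm.le
  have hμ1 : ∑ σ, μ σ = 1 := by
    rw [hμ, ← Finset.sum_div]
    exact div_self hperm.ne'
  let β : Matrix (Fin n) (Fin n) ℝ := fun i j => ∑ σ : Equiv.Perm (Fin n), if σ i = j then μ σ else 0
  have hβd : ∀ i j, β i j = ∑ σ : Equiv.Perm (Fin n), if σ i = j then μ σ else 0 := fun _ _ => rfl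
  have hβ0 : ∀ i j, 0 ≤ β i j := fun i j => Finset.sum_nonneg fun σ _ => by
    split_ifs; exacts [hμ0 σ, le_rfl]
  have hds : DoublyStochastic β := by
    refine ⟨hβ0, fun i => ?_, fun j => ?_⟩
    · simp only [hβd]
      rw [Finset.sum_comm]
      simpa using hμ1
    · simp only [hβd]
      rw [Finset.sum_comm]
      rw [← hμ1]
      apply Finset.sum_congr rfl
      intro σ _
      have : ∀ i, (σ i = j) = (i = σ.symm j) := fun i => by rw [Equiv.eq_symm_apply]
      simp [this]
  refine ⟨β, ⟨hds, fun i j hij => ?_⟩, ?_⟩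
  · apply Finset.sum_eq_zero
    intro σ _
    split_ifs with h
    · have : ∏ i, p i (σ i) = 0 := Finset.prod_eq_zero (Finset.mem_univ i) (by rw [h, hij])
      simp [hμ, this]
    · rfl
  set g : Fin n → Fin n → ℝ := fun i j => if 0 < p i j then Real.log (β i j / p i j) else 0 with hg
  have e1 : Ff 0 p β = ∑ σ, μ σ * ∑ i, g i (σ i) := by
    have : ∀ i, ∑ j, (if 0 < p i j then
        β i j * Real.log (β i j / p i j) + 0 * ((1 - β i j) * Real.log (1 - β i j)) else 0) = 
        ∑ σ, μ σ * g i (σ i) := by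
      intro i
      have h2 : ∀ j, (if 0 < p i j then
        β i j * Real.log (β i j / p i j) + 0 * ((1 - β i j) * Real.log (1 - β i j)) else 0) = 
        ∑ σ : Equiv.Perm (Fin n), if σ i = j then μ σ * g i j else 0 := by
        intro j
        have h3 : ∑ σ : Equiv.Perm (Fin n), (if σ i = j then μ σ * g i j else 0) = β i j * g i j := by
          rw [hβd, Finset.sum_mul]
          apply Finset.sum_congr rfl
          intro σ _
          split_ifs <;> simp
        rw [h3, hg]
        simp only
        split_ifs <;> simp
      simp_rw [h2]
      rw [Finset.sum_comm]
      simp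
    unfold Ff
    simp_rw [this]
    rw [Finset.sum_comm]
    simp_rw [Finset.mul_sum]
  have e2 : ∀ σ : Equiv.Perm (Fin n), 
      μ σ * ∑ i, g i (σ i) ≤ ∏ i, β i (σ i) - μ σ - μ σ * Real.log D := by
    intro σ
    have hB : 0 ≤ ∏ i, β i (σ i) := Finset.prod_nonneg fun i _ => hβ0 _ _
    rcases (hμ0 σ).eq_or_lt with h | h
    · rw [← h]; simpa using hB
    have hw : 0 < ∏ i, p i (σ i) := by
      have : ∏ i, p i (σ i) = μ σ * D := by simp only [hμ]; field_simp
      rw [this]; positivity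
    have hpp : ∀ i, 0 < p i (σ i) := by
      intro i
      refine lt_of_le_of_ne (hp _ _) fun h0 => hw.ne' ?_
      exact Finset.prod_eq_zero (Finset.mem_univ i) h0.symm
    have hbp : ∀ i, 0 < β i (σ i) := by
      intro i
      refine lt_of_lt_of_le h ?_
      have := Finset.single_le_sum (s := Finset.univ) 
        (f := fun τ : Equiv.Perm (Fin n) => if τ i = σ i then μ τ else 0) 
        (fun τ _ => by split_ifs; exacts [hμ0 τ, le_rfl]) (Finset.mem_univ σ)
      simpa [hβd] using this
    have hBp : 0 < ∏ i, β i (σ i) := Finset.prod_pos fun i _ => hbp i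
    have e3 : ∑ i, g i (σ i) = Real.log ((∏ i, β i (σ i)) / μ σ) - Real.log D := by
      have : ∑ i, g i (σ i) = ∑ i, Real.log (β i (σ i) / p i (σ i)) := 
        Finset.sum_congr rfl fun i _ => by simp [hg, hpp i]
      rw [this, ← Real.log_prod (fun i _ => (div_pos (hbp i) (hpp i)).ne'), Finset.prod_div_distrib,
        ← Real.log_div (by positivity) hperm.ne']
      congr 1
      simp only [hμ]
      field_simp
    rw [e3]
    have e4 := Real.log_le_sub_one_of_pos (div_pos hBp h)
    have e5 := mul_le_mul_of_nonneg_left e4 h.le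
    have e6 : μ σ * ((∏ i, β i (σ i)) / μ σ - 1) = ∏ i, β i (σ i) - μ σ := by field_simp
    linarith
  rw [e1]
  refine (Finset.sum_le_sum fun σ _ => e2 σ).trans ?_
  rw [Finset.sum_sub_distrib, Finset.sum_sub_distrib, ← Finset.sum_mul, hμ1]
  have := permanent_le_one β hds
  unfold permanent at this
  linarith

lemma Ff_lip (p β : Matrix (Fin n) (Fin n) ℝ) (hβ : InPolytope p β) (γ γ' : ℝ) :
    Ff γ p β ≤ Ff γ' p β + (n * n : ℝ) * |γ - γ'| := by
  have : Ff γ p β ≤ ∑ i, ∑ j, ((if 0 < p i j then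
    β i j * Real.log (β i j / p i j) + γ' * ((1 - β i j) * Real.log (1 - β i j)) else 0) + |γ - γ'|) := by
    apply Finset.sum_le_sum
    intro i _
    apply Finset.sum_le_sum
    intro j _
    split_ifs
    · have hb : |(1 - β i j) * Real.log (1 - β i j)| ≤ 1 := by
        rcases (hβ.le_one i j).eq_or_lt with h | h
        · simp [h]
        · rw [mul_comm]
          exact (Real.abs_log_mul_self_lt _ (by linarith) (by linarith [hβ.1.1 i j])).le
      have h2 : (γ - γ') * ((1 - β i j) * Real.log (1 - β i j)) ≤ |γ - γ'| := by
        refine (le_abs_self _).trans ?_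
        rw [abs_mul]
        nlinarith [abs_nonneg (γ - γ')]
      linarith
    · simp
  refine this.trans (le_of_eq ?_)
  simp [Finset.sum_add_distrib, Ff]
  ring

lemma Ff_anti (p β : Matrix (Fin n) (Fin n) ℝ) (hβ : InPolytope p β) {γ γ' : ℝ} (h : γ ≤ γ') :
    Ff γ' p β ≤ Ff γ p β := by
  apply Finset.sum_le_sum
  intro i _
  apply Finset.sum_le_sum
  intro j _
  split_ifs
  · have : (1 - β i j) * Real.log (1 - β i j) ≤ 0 := 
      mul_nonpos_of_nonneg_of_nonpos (by linarith [hβ.le_one i j]) 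
        (Real.log_nonpos (by linarith [hβ.le_one i j]) (by linarith [hβ.1.1 i j]))
    nlinarith
  · exact le_rfl

end Final

theorem exists_special_gamma {n : ℕ} (p : Matrix (Fin n) (Fin n) ℝ)
    (hp : ∀ i j, 0 ≤ p i j) (hperm : 0 < permanent p) :
    ∃ γs ∈ Set.Icc (-1 : ℝ) 0, permanent p = Zof γs p ∧
      (∀ γ ∈ Set.Icc (-1 : ℝ) γs, Zof γ p ≤ permanent p) ∧
      (∀ γ ∈ Set.Icc γs (1 : ℝ), permanent p ≤ Zof γ p) := by
  obtain ⟨β0, hβ0, hmf⟩ := mf_exists p hp hperm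
  have hbl : ∀ β, InPolytope p β → -Real.log (permanent p) ≤ Ff (-1) p β := by
    intro β hβ
    have := (Real.le_log_iff_exp_le hperm).2 (bethe_le p β hp hβ)
    linarith
  have hbdd : ∀ γ, BddBelow ((fun β => Ff γ p β) '' {β | InPolytope p β}) := by
    intro γ
    refine ⟨-Real.log (permanent p) - (n * n : ℝ) * |-1 - γ|, ?_⟩
    rintro _ ⟨β, hβ, rfl⟩
    have h1 := hbl β hβ
    have h2 := Ff_lip p β hβ (-1) γ
    simp only
    linarith
  have hne : ∀ γ, ((fun β => Ff γ p β) '' {β | InPolytope p β}).Nonempty := 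
    fun γ => ⟨_, β0, hβ0, rfl⟩
  have hcont : Continuous fun γ => sInf ((fun β => Ff γ p β) '' {β | InPolytope p β}) := by
    refine (LipschitzWith.of_le_add_mul (n * n : NNReal) ?_).continuous
    intro γ γ'
    rw [← sub_le_iff_le_add]
    apply le_csInf (hne γ')
    rintro _ ⟨β, hβ, rfl⟩
    have h1 := csInf_le (hbdd γ) ⟨β, hβ, rfl⟩
    have h2 := Ff_lip p β hβ γ γ'
    simp only [Real.dist_eq, NNReal.coe_mul, NNReal.coe_natCast] at h1 ⊢
    linarith
  have hZc : Continuous fun γ => Zof γ p := by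
    unfold Zof
    fun_prop
  have hmono : ∀ γ γ', γ ≤ γ' → Zof γ p ≤ Zof γ' p := by
    intro γ γ' h
    unfold Zof
    apply Real.exp_le_exp.2
    apply neg_le_neg
    apply le_csInf (hne γ)
    rintro _ ⟨β, hβ, rfl⟩
    exact (csInf_le (hbdd γ') ⟨β, hβ, rfl⟩).trans (Ff_anti p β hβ h)
  have hm1 : Zof (-1) p ≤ permanent p := by
    unfold Zof
    rw [← Real.le_log_iff_exp_le hperm]
    have := le_csInf (hne (-1)) (a := -Real.log (permanent p)) (by
      rintro _ ⟨β, hβ, rfl⟩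
      exact hbl β hβ)
    linarith
  have h0 : permanent p ≤ Zof 0 p := by
    unfold Zof
    rw [← Real.log_le_iff_le_exp hperm]
    have := (csInf_le (hbdd 0) ⟨β0, hβ0, rfl⟩).trans hmf
    linarith
  obtain ⟨γs, hγs, he⟩ := intermediate_value_Icc (by norm_num : (-1 : ℝ) ≤ 0) hZc.continuousOn ⟨hm1, h0⟩
  simp only at he
  refine ⟨γs, hγs, he.symm, fun γ hγ => ?_, fun γ hγ => ?_⟩
  · rw [← he]; exact hmono _ _ hγ.2
  · rw [← he]; exact hmono _ _ hγ.1
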